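/- arXiv:2601.18390 — 7 statements merged into one kernel-verified Lean document; each statement's English description precedes it below -/
import Mathlib

section
/- Under the stated hypotheses, ∫₀¹ | t_n^{-1} [ (B + t_n β_n)(u + t_n α_n(u)) − B(u) ] − β(u) − b(u)α(u) | du → 0 as n → ∞. (This is the Hadamard differentiability, tangentially to continuous perturbations, of the composition map (A, B) ↦ B ∘ A at (I, B), where I is the identity on [0,1], with derivative (α, β) ↦ β + bα into L¹[0,1].) -/
open MeasureTheory ProbabilityTheory Filter Set Topology

noncomputable section

open scoped Convolution in
/-- The function `u ↦ ∫ v in [u - δ, u + δ], |h v|` is integrable, and its integral is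
`2 * δ * ∫ |h|`. -/
theorem integrable_and_integral_setIntegral_Icc_abs {h : ℝ → ℝ} (hh : Integrable h) {δ : ℝ}
    (hδ : 0 ≤ δ) :
    Integrable (fun u => ∫ v in Icc (u - δ) (u + δ), |h v|) ∧
      ∫ u, ∫ v in Icc (u - δ) (u + δ), |h v| = 2 * δ * ∫ v, |h v| := by
  set f : ℝ → ℝ := (Icc (-δ) δ).indicator 1 with hf_def
  have hf : Integrable f :=
    (integrable_indicator_iff measurableSet_Icc).2 (integrableOn_const (by simp))
  have hf_int : ∫ x, f x = 2 * δ := by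
    rw [hf_def, integral_indicator_one measurableSet_Icc, Real.volume_real_Icc_of_le (by linarith)]
    ring
  have hconv : (fun u => ∫ v in Icc (u - δ) (u + δ), |h v|) =
      f ⋆[ContinuousLinearMap.mul ℝ ℝ, volume] (fun v => |h v|) := by
    ext u
    rw [convolution_mul_swap, ← integral_indicator measurableSet_Icc]
    refine integral_congr_ae (Eventually.of_forall fun v => ?_)
    have hmem : v ∈ Icc (u - δ) (u + δ) ↔ u - v ∈ Icc (-δ) δ := by
      simp only [mem_Icc]
      constructor <;> rintro ⟨h1, h2⟩ <;> constructor <;> linarith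
    by_cases hv : v ∈ Icc (u - δ) (u + δ)
    · simp only [hf_def, indicator_of_mem hv, indicator_of_mem (hmem.1 hv), Pi.one_apply, one_mul]
    · simp only [hf_def, indicator_of_notMem hv, indicator_of_notMem (fun H => hv (hmem.2 H)),
        zero_mul]
  rw [hconv]
  refine ⟨hf.integrable_convolution _ hh.abs, ?_⟩
  rw [integral_convolution _ hf hh.abs, hf_int]
  rfl

/-- An interval integral over an interval starting at `u` of length at most `δ` is bounded by the
integral of the absolute value over `[u - δ, u + δ]`. -/
theorem abs_intervalIntegral_le_setIntegral_Icc_abs {h : ℝ → ℝ} (hh : Integrable h) {u w δ : ℝ}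
    (hw : |w - u| ≤ δ) :
    |∫ v in u..w, h v| ≤ ∫ v in Icc (u - δ) (u + δ), |h v| := by
  refine (intervalIntegral.norm_integral_le_integral_norm_uIoc (f := h)).trans ?_
  refine setIntegral_mono_set hh.abs.integrableOn
    (Eventually.of_forall fun _ => abs_nonneg _) (Eventually.of_forall ?_)
  rw [abs_le] at hw
  have hsub : uIcc u w ⊆ Icc (u - δ) (u + δ) :=
    ordConnected_Icc.uIcc_subset ⟨by linarith, by linarith⟩ ⟨by linarith, by linarith⟩
  exact uIoc_subset_uIcc.trans hsub

/-- If `βn → β` uniformly on a compact set `s`, `β` is continuous on `s` and `An → id` uniformly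
on `s` with values in `s`, then `βn ∘ An → β` uniformly on `s`. -/
theorem tendstoUniformlyOn_comp_of_tendsto_id {s : Set ℝ} (hs : IsCompact s) {β : ℝ → ℝ}
    (hβ : ContinuousOn β s) {βn An : ℕ → ℝ → ℝ} (hβu : TendstoUniformlyOn βn β atTop s)
    (hA : ∀ n, MapsTo (An n) s s) (hAu : TendstoUniformlyOn An id atTop s) :
    TendstoUniformlyOn (fun n u => βn n (An n u)) β atTop s := by
  rw [Metric.tendstoUniformlyOn_iff] at *
  intro ε hε
  obtain ⟨δ, hδ, hβδ⟩ := Metric.uniformContinuousOn_iff.1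
    (hs.uniformContinuousOn_of_continuous hβ) (ε / 2) (half_pos hε)
  filter_upwards [hβu (ε / 2) (half_pos hε), hAu δ hδ] with n h1 h2 u hu
  calc dist (β u) (βn n (An n u))
      ≤ dist (β u) (β (An n u)) + dist (β (An n u)) (βn n (An n u)) := dist_triangle _ _ _
    _ < ε / 2 + ε / 2 := add_lt_add (hβδ u hu _ (hA n hu) (h2 u hu)) (h1 _ (hA n hu))
    _ = ε := add_halves ε

/-- Difference quotients of a primitive of a bounded uniformly continuous function `g` along
perturbations `t n * αn n u` converge uniformly to `g * α`. -/
theorem tendstoUniformlyOn_inv_mul_intervalIntegral {s : Set ℝ} {g : ℝ → ℝ} (hg : Continuous g)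
    (hgu : UniformContinuous g) {C : ℝ} (hC : ∀ x, |g x| ≤ C) {t : ℕ → ℝ} (ht : ∀ n, 0 < t n)
    (ht0 : Tendsto t atTop (𝓝 0)) {α : ℝ → ℝ} {αn : ℕ → ℝ → ℝ}
    (hαu : TendstoUniformlyOn αn α atTop s) {M : ℝ} (hM : 0 < M)
    (hαM : ∀ᶠ n in atTop, ∀ u ∈ s, |αn n u| ≤ M) :
    TendstoUniformlyOn (fun n u => (t n)⁻¹ * ∫ v in u..(u + t n * αn n u), g v)
      (fun u => g u * α u) atTop s := by
  rw [Metric.tendstoUniformlyOn_iff] at *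
  intro ε hε
  have hC0 : 0 ≤ C := (abs_nonneg _).trans (hC 0)
  obtain ⟨δ, hδ, hgδ⟩ := Metric.uniformContinuous_iff.1 hgu (ε / (2 * M)) (by positivity)
  have htM : ∀ᶠ n in atTop, t n < δ / M := ht0.eventually_lt_const (by positivity)
  filter_upwards [hαu (ε / (2 * (C + 1))) (by positivity), hαM, htM] with n h1 h2 h3 u hu
  have htn := ht n
  have hlen : |t n * αn n u| ≤ t n * M := by
    rw [abs_mul, abs_of_pos htn]
    exact mul_le_mul_of_nonneg_left (h2 u hu) htn.le
  have hlenδ : t n * M < δ := (lt_div_iff₀ hM).1 h3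
  have hsub : (∫ v in u..(u + t n * αn n u), g v) - t n * αn n u * g u =
      ∫ v in u..(u + t n * αn n u), (g v - g u) := by
    rw [intervalIntegral.integral_sub (hg.intervalIntegrable _ _) (by simp)]
    simp
  have hbound : |(∫ v in u..(u + t n * αn n u), g v) - t n * αn n u * g u| ≤
      ε / (2 * M) * (t n * M) := by
    rw [hsub]
    refine (intervalIntegral.norm_integral_le_of_norm_le_const (E := ℝ) (C := ε / (2 * M))
      fun v hv => ?_).trans ?_
    · refine (hgδ ?_).le
      have := abs_sub_left_of_mem_uIcc (uIoc_subset_uIcc hv)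
      rw [add_sub_cancel_left] at this
      exact (this.trans hlen).trans_lt hlenδ
    · rw [add_sub_cancel_left]
      gcongr
  have hfst : |(t n)⁻¹ * (∫ v in u..(u + t n * αn n u), g v) - g u * αn n u| ≤ ε / 2 := by
    have : (t n)⁻¹ * (∫ v in u..(u + t n * αn n u), g v) - g u * αn n u =
        (t n)⁻¹ * ((∫ v in u..(u + t n * αn n u), g v) - t n * αn n u * g u) := by
      field_simp
    rw [this, abs_mul, abs_of_pos (inv_pos.2 htn)]
    calc _ ≤ (t n)⁻¹ * (ε / (2 * M) * (t n * M)) := by gcongr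
      _ = ε / 2 := by field_simp
  have hsnd : |g u * (αn n u - α u)| < ε / 2 := by
    have h4 := h1 u hu
    rw [dist_comm, Real.dist_eq] at h4
    rw [abs_mul]
    calc |g u| * |αn n u - α u| ≤ C * |αn n u - α u| := by gcongr; exact hC u
      _ ≤ (C + 1) * |αn n u - α u| := by gcongr; linarith
      _ < (C + 1) * (ε / (2 * (C + 1))) := by gcongr
      _ = ε / 2 := by field_simp
  rw [dist_comm, Real.dist_eq]
  calc _ = |((t n)⁻¹ * (∫ v in u..(u + t n * αn n u), g v) - g u * αn n u)
        + g u * (αn n u - α u)| := by ring_nf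
    _ ≤ _ := abs_add_le _ _
    _ < ε := by linarith

/-- Hadamard differentiability of the composition map, tangentially to continuous
perturbations: under the stated hypotheses,
`∫₀¹ | tₙ⁻¹ [(B + tₙ βₙ)(u + tₙ αₙ(u)) − B(u)] − β(u) − b(u)α(u) | du → 0`. -/
theorem composition_hadamard_differentiable
    (B b : ℝ → ℝ) (hb : IntegrableOn b (Set.Icc (0 : ℝ) 1))
    (hB : ∀ u ∈ Set.Icc (0 : ℝ) 1, B u = B 0 + ∫ v in (0 : ℝ)..u, b v)
    (t : ℕ → ℝ) (ht : ∀ n, 0 < t n) (ht0 : Tendsto t atTop (𝓝 0))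
    (α β : ℝ → ℝ)
    (hα : ContinuousOn α (Set.Icc (0 : ℝ) 1)) (hβ : ContinuousOn β (Set.Icc (0 : ℝ) 1))
    (αn βn : ℕ → ℝ → ℝ)
    (hαnb : ∀ n, ∃ M, ∀ u ∈ Set.Icc (0 : ℝ) 1, |αn n u| ≤ M)
    (hβnb : ∀ n, ∃ M, ∀ u ∈ Set.Icc (0 : ℝ) 1, |βn n u| ≤ M)
    (hαu : TendstoUniformlyOn αn α atTop (Set.Icc (0 : ℝ) 1))
    (hβu : TendstoUniformlyOn βn β atTop (Set.Icc (0 : ℝ) 1))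
    (hA : ∀ n, AEMeasurable (fun u => u + t n * αn n u) (volume.restrict (Set.Icc (0 : ℝ) 1)))
    (hA01 : ∀ n, ∀ u ∈ Set.Icc (0 : ℝ) 1, u + t n * αn n u ∈ Set.Icc (0 : ℝ) 1)
    (hBn : ∀ n, Measurable fun u => B u + t n * βn n u) :
    Tendsto (fun n => ∫ u in Set.Icc (0 : ℝ) 1,
      |(t n)⁻¹ * ((B (u + t n * αn n u) + t n * βn n (u + t n * αn n u)) - B u)
        - β u - b u * α u|) atTop (𝓝 0) := by
  obtain ⟨M₀, hM₀⟩ := isCompact_Icc.exists_bound_of_continuousOn hα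
  set M : ℝ := |M₀| + 1 with hM_def
  have hM : 0 < M := by positivity
  have hα_le : ∀ u ∈ Icc (0 : ℝ) 1, |α u| ≤ |M₀| := fun u hu => (hM₀ u hu).trans (le_abs_self _)
  have hαM : ∀ᶠ n in atTop, ∀ u ∈ Icc (0 : ℝ) 1, |αn n u| ≤ M := by
    filter_upwards [Metric.tendstoUniformlyOn_iff.1 hαu 1 one_pos] with n hn u hu
    have h1 := hn u hu
    rw [dist_comm, Real.dist_eq] at h1
    have h2 := abs_sub_abs_le_abs_sub (αn n u) (α u)
    have h3 := hα_le u hu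
    linarith
  have hAu : TendstoUniformlyOn (fun n u => u + t n * αn n u) id atTop (Icc (0 : ℝ) 1) := by
    rw [Metric.tendstoUniformlyOn_iff]
    intro ε hε
    filter_upwards [hαM, ht0.eventually_lt_const (show 0 < ε / M by positivity)] with n h1 h2 u hu
    rw [dist_comm, Real.dist_eq, id, add_sub_cancel_left, abs_mul, abs_of_pos (ht n)]
    calc t n * |αn n u| ≤ t n * M := mul_le_mul_of_nonneg_left (h1 u hu) (ht n).le
      _ < ε := (lt_div_iff₀ hM).1 h2
  have hβA := tendstoUniformlyOn_comp_of_tendsto_id isCompact_Icc hβ hβu hA01 hAu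
  have hb' : Integrable ((Icc (0 : ℝ) 1).indicator b) :=
    (integrable_indicator_iff measurableSet_Icc).2 hb
  have hBsub : ∀ u ∈ Icc (0 : ℝ) 1, ∀ w ∈ Icc (0 : ℝ) 1,
      B w - B u = ∫ v in u..w, (Icc (0 : ℝ) 1).indicator b v := by
    intro u hu w hw
    have hint : ∀ x ∈ Icc (0 : ℝ) 1, IntervalIntegrable b volume 0 x := fun x hx =>
      (intervalIntegrable_iff_integrableOn_Icc_of_le hx.1).2
        (hb.mono_set (Icc_subset_Icc_right hx.2))
    rw [hB w hw, hB u hu, add_sub_add_left_eq_sub,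
      intervalIntegral.integral_interval_sub_left (hint w hw) (hint u hu)]
    refine intervalIntegral.integral_congr fun v hv => ?_
    rw [indicator_of_mem (ordConnected_Icc.uIcc_subset hu hw hv)]
  rw [Metric.tendsto_nhds]
  intro ε hε
  obtain ⟨g, hgc, hg_le, hg, hgi⟩ :=
    hb'.exists_hasCompactSupport_integral_sub_le (show 0 < ε / (12 * M) by positivity)
  obtain ⟨C, hC⟩ := hgc.exists_bound_of_continuous hg
  set h : ℝ → ℝ := fun v => (Icc (0 : ℝ) 1).indicator b v - g v with h_def
  have hh : Integrable h := hb'.sub hgi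
  have hgA := tendstoUniformlyOn_inv_mul_intervalIntegral hg (hgc.uniformContinuous_of_continuous hg)
    hC ht ht0 hαu hM hαM
  filter_upwards [hαM, Metric.tendstoUniformlyOn_iff.1 hβA (ε / 4) (by positivity),
    Metric.tendstoUniformlyOn_iff.1 hgA (ε / 4) (by positivity)] with n h1 h2 h3
  have htn := ht n
  obtain ⟨hki, hk⟩ := integrable_and_integral_setIntegral_Icc_abs hh (mul_pos htn hM).le
  set k : ℝ → ℝ := fun u => ∫ v in Icc (u - t n * M) (u + t n * M), |h v| with k_def
  have hk0 : ∀ u, 0 ≤ k u := fun u => integral_nonneg fun _ => abs_nonneg _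
  have hpt : ∀ u ∈ Icc (0 : ℝ) 1,
      |(t n)⁻¹ * ((B (u + t n * αn n u) + t n * βn n (u + t n * αn n u)) - B u)
        - β u - b u * α u| ≤ ε / 2 + ((t n)⁻¹ * k u + M * |h u|) := by
    intro u hu
    have hβ' := h2 u hu
    have hg' := h3 u hu
    rw [dist_comm, Real.dist_eq] at hβ' hg'
    have hh' : |(t n)⁻¹ * ∫ v in u..(u + t n * αn n u), h v| ≤ (t n)⁻¹ * k u := by
      rw [abs_mul, abs_of_pos (inv_pos.2 htn)]
      gcongr
      refine abs_intervalIntegral_le_setIntegral_Icc_abs hh ?_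
      rw [add_sub_cancel_left, abs_mul, abs_of_pos htn]
      exact mul_le_mul_of_nonneg_left (h1 u hu) htn.le
    have hhα : |h u * α u| ≤ M * |h u| := by
      rw [abs_mul, mul_comm]
      gcongr
      linarith [hα_le u hu]
    have hBu : B (u + t n * αn n u) =
        B u + ((∫ v in u..(u + t n * αn n u), h v) + ∫ v in u..(u + t n * αn n u), g v) := by
      rw [← intervalIntegral.integral_add hh.intervalIntegrable hgi.intervalIntegrable]
      have := hBsub u hu _ (hA01 n u hu)
      simp only [h_def, sub_add_cancel]
      linarith
    have hbu : b u = h u + g u := by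
      simp only [h_def, indicator_of_mem hu, sub_add_cancel]
    have hsplit : (t n)⁻¹ * ((B (u + t n * αn n u) + t n * βn n (u + t n * αn n u)) - B u)
        - β u - b u * α u = (βn n (u + t n * αn n u) - β u)
        + ((t n)⁻¹ * (∫ v in u..(u + t n * αn n u), g v) - g u * α u)
        + (t n)⁻¹ * (∫ v in u..(u + t n * αn n u), h v) - h u * α u := by
      rw [hBu, hbu]
      field_simp
      ring
    rw [hsplit]
    rw [abs_le] at hh' hhα ⊢
    rw [abs_lt] at hβ' hg'
    constructor <;> linarith [hβ'.1, hβ'.2, hg'.1, hg'.2, hh'.1, hh'.2, hhα.1, hhα.2]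
  have hdom : Integrable fun u => (t n)⁻¹ * k u + M * |h u| :=
    (hki.const_mul _).add (hh.abs.const_mul _)
  have hconst : IntegrableOn (fun _ : ℝ => ε / 2) (Icc (0 : ℝ) 1) :=
    integrableOn_const (by simp)
  have hle : ∫ u in Icc (0 : ℝ) 1,
      |(t n)⁻¹ * ((B (u + t n * αn n u) + t n * βn n (u + t n * αn n u)) - B u)
        - β u - b u * α u| ≤ ε / 2 + ε / 4 := by
    calc _ ≤ ∫ u in Icc (0 : ℝ) 1, (ε / 2 + ((t n)⁻¹ * k u + M * |h u|)) :=
          integral_mono_of_nonneg (Eventually.of_forall fun _ => abs_nonneg _)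
            (hconst.add hdom.integrableOn)
            ((ae_restrict_iff' measurableSet_Icc).2 (Eventually.of_forall hpt))
      _ = ε / 2 + ∫ u in Icc (0 : ℝ) 1, ((t n)⁻¹ * k u + M * |h u|) := by
          rw [integral_add hconst hdom.integrableOn]
          simp
      _ ≤ ε / 2 + ∫ u, ((t n)⁻¹ * k u + M * |h u|) := by
          refine add_le_add le_rfl
            (setIntegral_le_integral hdom (Eventually.of_forall fun u => ?_))
          have := hk0 u
          simp only [Pi.zero_apply]
          positivity
      _ = ε / 2 + 3 * M * ∫ u, |h u| := by
          rw [integral_add (hki.const_mul _) (hh.abs.const_mul _), integral_const_mul,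
            integral_const_mul, hk]
          field_simp
          ring
      _ ≤ ε / 2 + 3 * M * (ε / (12 * M)) := by
          gcongr
          exact hg_le
      _ = ε / 2 + ε / 4 := by
          field_simp
          norm_num
  rw [Real.dist_eq, sub_zero, abs_of_nonneg (integral_nonneg fun _ => abs_nonneg _)]
  linarith
end
end

section
/- Under the stated hypotheses, ∫₀¹ | t_n^{-1} [ B(u + t_n α_n(u)) − B(u) ] − b(u)α(u) | du → 0 as n → ∞. -/
open MeasureTheory ProbabilityTheory Filter Set Topology

noncomputable section

/-- Translation is continuous in `L¹(ℝ)`. -/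
theorem tendsto_lintegral_enorm_translate_sub {c : ℝ → ℝ} (hc : Integrable c) :
    Tendsto (fun v : ℝ => ∫⁻ u, ‖c (u + v) - c u‖ₑ) (𝓝 0) (𝓝 0) := by
  have hmem : MemLp c 1 := memLp_one_iff_integrable.2 hc
  let g : ℝ → C(ℝ, ℝ) := fun v => ⟨fun u => u + v, by fun_prop⟩
  have hg : Continuous g :=
    ContinuousMap.continuous_of_continuous_uncurry g
      (by simp only [Function.uncurry_def, g, ContinuousMap.coe_mk]; fun_prop)
  have hgm : ∀ v, MeasurePreserving (g v) volume volume := fun v =>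
    measurePreserving_add_right volume v
  have hcont := (continuous_const (y := hmem.toLp c)).compMeasurePreservingLp hg hgm
    ENNReal.one_ne_top
  have h := tendsto_iff_edist_tendsto_0.1 (hcont.tendsto 0)
  refine h.congr fun v => ?_
  simp only [Lp.toLp_compMeasurePreserving hmem, Lp.edist_toLp_toLp,
    eLpNorm_one_eq_lintegral_enorm]
  simp [g]

theorem lintegral_enorm_translate_sub_le {c : ℝ → ℝ} (hcm : Measurable c) (v : ℝ) :
    ∫⁻ u, ‖c (u + v) - c u‖ₑ ≤ 2 * ∫⁻ u, ‖c u‖ₑ := by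
  calc ∫⁻ u, ‖c (u + v) - c u‖ₑ ≤ ∫⁻ u, (‖c (u + v)‖ₑ + ‖c u‖ₑ) :=
        lintegral_mono fun u => enorm_sub_le
    _ = 2 * ∫⁻ u, ‖c u‖ₑ := by
        rw [lintegral_add_right _ hcm.enorm, lintegral_add_right_eq_self (fun u => ‖c u‖ₑ) v,
          two_mul]

theorem tendsto_lintegral_lintegral_enorm_translate_sub {c : ℝ → ℝ} (hcm : Measurable c)
    (hc : Integrable c) {t : ℕ → ℝ} (ht0 : Tendsto t atTop (𝓝 0)) (M : ℝ) :
    Tendsto (fun n => ∫⁻ u, ∫⁻ w in Icc (-M) M, ‖c (u + t n * w) - c u‖ₑ) atTop (𝓝 0) := by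
  have hmeas (s : ℝ) : Measurable fun p : ℝ × ℝ => ‖c (p.1 + s * p.2) - c p.1‖ₑ := by fun_prop
  have hswap (n : ℕ) : ∫⁻ u, ∫⁻ w in Icc (-M) M, ‖c (u + t n * w) - c u‖ₑ
      = ∫⁻ w in Icc (-M) M, ∫⁻ u, ‖c (u + t n * w) - c u‖ₑ :=
    lintegral_lintegral_swap (hmeas (t n)).aemeasurable
  simp_rw [hswap]
  have key := tendsto_lintegral_filter_of_dominated_convergence
    (μ := volume.restrict (Icc (-M) M)) (l := atTop)
    (F := fun (n : ℕ) w => ∫⁻ u, ‖c (u + t n * w) - c u‖ₑ) (f := fun _ => 0)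
    (fun _ => 2 * ∫⁻ u, ‖c u‖ₑ)
    (Eventually.of_forall fun n => (hmeas (t n)).lintegral_prod_left')
    (Eventually.of_forall fun n => Eventually.of_forall fun w =>
      lintegral_enorm_translate_sub_le hcm _)
    (by
      rw [lintegral_const]
      exact ENNReal.mul_ne_top (ENNReal.mul_ne_top (by simp) hc.2.ne) (by simp))
    (Eventually.of_forall fun w =>
      (tendsto_lintegral_enorm_translate_sub hc).comp (by simpa using ht0.mul_const w))
  simpa using key

theorem enorm_average_sub_le {c : ℝ → ℝ} (hc : Integrable c) {s a M : ℝ} (hs : 0 < s)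
    (ha : |a| ≤ M) (x : ℝ) :
    ‖s⁻¹ * (∫ v in x..x + s * a, c v) - c x * a‖ₑ
      ≤ ∫⁻ w in Icc (-M) M, ‖c (x + s * w) - c x‖ₑ := by
  have h1 : s * (∫ w in (0 : ℝ)..a, c (x + s * w)) = ∫ v in x..x + s * a, c v := by
    simp
  have hint : IntervalIntegrable (fun w => c (x + s * w)) volume 0 a :=
    ((hc.comp_add_left x).comp_mul_left' hs.ne').intervalIntegrable
  have h2 : s⁻¹ * (∫ v in x..x + s * a, c v) - c x * a
      = ∫ w in (0 : ℝ)..a, (c (x + s * w) - c x) := by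
    rw [intervalIntegral.integral_sub hint intervalIntegrable_const, ← h1,
      inv_mul_cancel_left₀ hs.ne']
    simp [mul_comm]
  have hsub : uIoc 0 a ⊆ Icc (-M) M := by
    obtain ⟨hl, hr⟩ := abs_le.1 ha
    have hM : 0 ≤ M := (abs_nonneg a).trans ha
    exact uIoc_subset_uIcc.trans (uIcc_subset_Icc ⟨by linarith, hM⟩ ⟨hl, hr⟩)
  calc ‖s⁻¹ * (∫ v in x..x + s * a, c v) - c x * a‖ₑ
      = ‖∫ w in uIoc 0 a, (c (x + s * w) - c x)‖ₑ := by
        rw [h2, ← enorm_norm, intervalIntegral.norm_intervalIntegral_eq, enorm_norm]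
    _ ≤ ∫⁻ w in uIoc 0 a, ‖c (x + s * w) - c x‖ₑ := enorm_integral_le_lintegral_enorm _
    _ ≤ _ := lintegral_mono_set hsub

/-- An integrable function on a measurable set agrees there almost everywhere with a measurable
function that is integrable on the whole space. -/
theorem exists_measurable_integrable_ae_eq_restrict {X : Type*} [MeasurableSpace X]
    {μ : Measure X} {b : X → ℝ} {S : Set X} (hS : MeasurableSet S) (hb : IntegrableOn b S μ) :
    ∃ c : X → ℝ, Measurable c ∧ Integrable c μ ∧ b =ᵐ[μ.restrict S] c := by
  have hmk := hb.1.ae_eq_mk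
  refine ⟨S.indicator (hb.1.mk b), hb.1.stronglyMeasurable_mk.measurable.indicator hS,
    (integrable_indicator_iff hS).2 (Integrable.congr hb hmk), ?_⟩
  filter_upwards [hmk, ae_restrict_mem hS] with u hu huS
  rw [indicator_of_mem huS, hu]

/-- Under the stated hypotheses, `∫₀¹ | tₙ⁻¹ [B(u + tₙ αₙ(u)) − B(u)] − b(u)α(u) | du → 0`. -/
theorem composition_difference_quotient_tendsto
    (B b : ℝ → ℝ) (hb : IntegrableOn b (Set.Icc (0 : ℝ) 1))
    (hB : ∀ u ∈ Set.Icc (0 : ℝ) 1, B u = B 0 + ∫ v in (0 : ℝ)..u, b v)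
    (t : ℕ → ℝ) (ht : ∀ n, 0 < t n) (ht0 : Tendsto t atTop (𝓝 0))
    (α : ℝ → ℝ) (hα : ContinuousOn α (Set.Icc (0 : ℝ) 1))
    (αn : ℕ → ℝ → ℝ)
    (hαnb : ∀ n, ∃ M, ∀ u ∈ Set.Icc (0 : ℝ) 1, |αn n u| ≤ M)
    (hαu : TendstoUniformlyOn αn α atTop (Set.Icc (0 : ℝ) 1))
    (hA : ∀ n, AEMeasurable (fun u => u + t n * αn n u) (volume.restrict (Set.Icc (0 : ℝ) 1)))
    (hA01 : ∀ n, ∀ u ∈ Set.Icc (0 : ℝ) 1, u + t n * αn n u ∈ Set.Icc (0 : ℝ) 1) :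
    Tendsto (fun n => ∫ u in Set.Icc (0 : ℝ) 1,
      |(t n)⁻¹ * (B (u + t n * αn n u) - B u) - b u * α u|) atTop (𝓝 0) := by
  obtain ⟨c, hcm, hc, hbc⟩ := exists_measurable_integrable_ae_eq_restrict measurableSet_Icc hb
  have hBc : ∀ u ∈ Icc (0 : ℝ) 1, B u = B 0 + ∫ v in (0 : ℝ)..u, c v := by
    intro u hu
    rw [hB u hu, intervalIntegral.integral_of_le hu.1, intervalIntegral.integral_of_le hu.1]
    congr 1
    refine integral_congr_ae (ae_restrict_of_ae_restrict_of_subset ?_ hbc)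
    exact Ioc_subset_Icc_self.trans (Icc_subset_Icc_right hu.2)
  have hBsub : ∀ x ∈ Icc (0 : ℝ) 1, ∀ y ∈ Icc (0 : ℝ) 1, B y - B x = ∫ v in x..y, c v := by
    intro x hx y hy
    rw [hBc x hx, hBc y hy, add_sub_add_left_eq_sub,
      intervalIntegral.integral_interval_sub_left hc.intervalIntegrable hc.intervalIntegrable]
  obtain ⟨K, hK⟩ := isCompact_Icc.exists_bound_of_continuousOn hα
  suffices h : Tendsto (fun n => ∫⁻ u in Icc (0 : ℝ) 1,
      ‖(t n)⁻¹ * (B (u + t n * αn n u) - B u) - b u * α u‖ₑ) atTop (𝓝 0) by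
    rw [tendsto_zero_iff_enorm_tendsto_zero]
    refine tendsto_of_tendsto_of_tendsto_of_le_of_le tendsto_const_nhds h
      (fun _ => zero_le) fun n => ?_
    refine (enorm_integral_le_lintegral_enorm _).trans_eq ?_
    simp only [← Real.norm_eq_abs, enorm_norm]
  rw [ENNReal.tendsto_nhds_zero]
  intro ε hε
  have hε2 : ε / 2 ≠ 0 := (ENNReal.half_pos hε.ne').ne'
  obtain ⟨δ, hδ, hδε⟩ := ENNReal.exists_nnreal_pos_mul_lt hc.2.ne hε2
  have hmain := ENNReal.tendsto_nhds_zero.1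
    (tendsto_lintegral_lintegral_enorm_translate_sub hcm hc ht0 (K + 1)) (ε / 2)
    (pos_iff_ne_zero.2 hε2)
  rw [Metric.tendstoUniformlyOn_iff] at hαu
  filter_upwards [hmain, hαu 1 one_pos, hαu δ hδ] with n hn h1 hnδ
  calc ∫⁻ u in Icc (0 : ℝ) 1, ‖(t n)⁻¹ * (B (u + t n * αn n u) - B u) - b u * α u‖ₑ
      ≤ ∫⁻ u in Icc (0 : ℝ) 1, ((∫⁻ w in Icc (-(K + 1)) (K + 1), ‖c (u + t n * w) - c u‖ₑ)
          + δ * ‖c u‖ₑ) := by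
        refine lintegral_mono_ae ?_
        filter_upwards [hbc, ae_restrict_mem measurableSet_Icc] with u hu huI
        have hbd : |αn n u| ≤ K + 1 := by
          have hKu := hK u huI
          have hd := h1 u huI
          rw [Real.norm_eq_abs] at hKu
          rw [Real.dist_eq, abs_sub_comm] at hd
          have := abs_sub_abs_le_abs_sub (αn n u) (α u)
          linarith
        have herr : ‖αn n u - α u‖ₑ ≤ δ := by
          rw [← edist_eq_enorm_sub, edist_comm, edist_le_coe]
          exact (hnδ u huI).le
        have hsplit : (t n)⁻¹ * (B (u + t n * αn n u) - B u) - b u * α u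
            = ((t n)⁻¹ * (∫ v in u..u + t n * αn n u, c v) - c u * αn n u)
              + (αn n u - α u) * c u := by
          rw [hBsub u huI _ (hA01 n u huI), hu]
          ring
        rw [hsplit]
        refine (enorm_add_le _ _).trans (add_le_add (enorm_average_sub_le hc (ht n) hbd u) ?_)
        rw [enorm_mul]
        gcongr
    _ ≤ ∫⁻ u, ((∫⁻ w in Icc (-(K + 1)) (K + 1), ‖c (u + t n * w) - c u‖ₑ) + δ * ‖c u‖ₑ) :=
        setLIntegral_le_lintegral _ _
    _ = (∫⁻ u, ∫⁻ w in Icc (-(K + 1)) (K + 1), ‖c (u + t n * w) - c u‖ₑ)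
          + δ * ∫⁻ u, ‖c u‖ₑ := by
        rw [lintegral_add_right _ (hcm.enorm.const_mul _), lintegral_const_mul _ hcm.enorm]
    _ ≤ ε / 2 + ε / 2 := add_le_add hn hδε.le
    _ = ε := ENNReal.add_halves ε
end
end

section
/- Define ζ_n : [0,1] → ℝ by ζ_n(u) = t_n^{-1} ∫₀¹ [ 1(v ≤ u + t_n α(u)) − 1(v ≤ u) ] b(v) dv. Then ∫₀¹ | ζ_n(u) − b(u)α(u) | du → 0 as n → ∞. -/
open MeasureTheory ProbabilityTheory Filter Set Topology

noncomputable section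

/-- The signed indicator of the interval between `u` and `x`. -/
def stepDiff (x u v : ℝ) : ℝ := (if v ≤ x then (1 : ℝ) else 0) - (if v ≤ u then 1 else 0)

lemma abs_stepDiff_le {x u r : ℝ} (h : |x - u| ≤ r) (v : ℝ) :
    |stepDiff x u v| ≤ if |v - u| ≤ r then 1 else 0 := by
  unfold stepDiff
  rw [abs_le] at h
  split_ifs with h1 h2 h3 h3 h2 h3 h3 <;> simp only [abs_le] at * <;> norm_num <;> grind

lemma measurable_stepDiff {a : ℝ → ℝ} (ha : Measurable a) (t : ℝ) :
    Measurable fun p : ℝ × ℝ => stepDiff (p.1 + t * a p.1) p.1 p.2 := by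
  unfold stepDiff
  refine Measurable.sub ?_ ?_
  · exact Measurable.ite (measurableSet_le (by fun_prop) (by fun_prop))
      measurable_const measurable_const
  · exact Measurable.ite (measurableSet_le (by fun_prop) (by fun_prop))
      measurable_const measurable_const

lemma integral_ite_abs_sub_le {r : ℝ} (hr : 0 ≤ r) (u : ℝ) (s : Set ℝ) :
    ∫ v in s, (if |v - u| ≤ r then (1 : ℝ) else 0) ≤ 2 * r := by
  have h : (fun v : ℝ => if |v - u| ≤ r then (1 : ℝ) else 0)
      = (Metric.closedBall u r).indicator 1 := by
    ext v
    simp [Set.indicator, Metric.mem_closedBall, Real.dist_eq]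
  rw [h, integral_indicator_one Metric.isClosed_closedBall.measurableSet]
  calc (volume.restrict s).real (Metric.closedBall u r)
      ≤ volume.real (Metric.closedBall u r) :=
        ENNReal.toReal_mono measure_closedBall_lt_top.ne (Measure.restrict_apply_le _ _)
    _ = 2 * r := by simp [measureReal_def, Real.volume_closedBall, hr]

lemma measurable_ite_abs_sub_le (r : ℝ) :
    Measurable fun p : ℝ × ℝ => if |p.2 - p.1| ≤ r then (1 : ℝ) else 0 :=
  Measurable.ite (measurableSet_le (by fun_prop) (by fun_prop)) measurable_const measurable_const

section

variable {s : Set ℝ} {f a : ℝ → ℝ} {t M : ℝ}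

lemma integrable_prod_stepDiff_mul [IsFiniteMeasure (volume.restrict s)]
    (hf : IntegrableOn f s) (ha : Measurable a) (t : ℝ) :
    Integrable (fun p : ℝ × ℝ => stepDiff (p.1 + t * a p.1) p.1 p.2 * f p.2)
      ((volume.restrict s).prod (volume.restrict s)) := by
  refine (Integrable.comp_snd hf (volume.restrict s)).bdd_mul (c := 1)
    (measurable_stepDiff ha t).aestronglyMeasurable (ae_of_all _ fun p => ?_)
  rw [Real.norm_eq_abs]
  refine (abs_stepDiff_le le_rfl _).trans ?_
  split_ifs <;> norm_num

lemma integrable_prod_ite_abs_sub_le_mul [IsFiniteMeasure (volume.restrict s)]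
    (hf : IntegrableOn f s) (r : ℝ) :
    Integrable (fun p : ℝ × ℝ => (if |p.2 - p.1| ≤ r then (1 : ℝ) else 0) * |f p.2|)
      ((volume.restrict s).prod (volume.restrict s)) := by
  refine (Integrable.comp_snd hf.abs (volume.restrict s)).bdd_mul (c := 1)
    (measurable_ite_abs_sub_le r).aestronglyMeasurable (ae_of_all _ fun p => ?_)
  split_ifs <;> norm_num

lemma abs_integral_stepDiff_mul_le (hf : IntegrableOn f s) (u : ℝ) {x r : ℝ}
    (h : |x - u| ≤ r) :
    |∫ v in s, stepDiff x u v * f v| ≤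
      ∫ v in s, (if |v - u| ≤ r then (1 : ℝ) else 0) * |f v| := by
  refine norm_integral_le_of_norm_le (f := fun v => stepDiff x u v * f v) ?_
    (ae_of_all _ fun v => ?_)
  · refine hf.abs.bdd_mul (c := 1)
      ((measurable_ite_abs_sub_le r).comp (measurable_const.prodMk measurable_id)
        : Measurable fun v : ℝ => if |v - u| ≤ r then (1 : ℝ) else 0).aestronglyMeasurable
      (ae_of_all _ fun v => ?_)
    split_ifs <;> norm_num
  · rw [Real.norm_eq_abs, abs_mul]
    exact mul_le_mul_of_nonneg_right (abs_stepDiff_le h v) (abs_nonneg _)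

lemma integral_abs_integral_stepDiff_le [IsFiniteMeasure (volume.restrict s)]
    (hf : IntegrableOn f s) (ha : Measurable a) (haM : ∀ u, |a u| ≤ M) (ht : 0 < t) :
    ∫ u in s, |t⁻¹ * ∫ v in s, stepDiff (u + t * a u) u v * f v|
      ≤ 2 * M * ∫ v in s, |f v| := by
  have hM : 0 ≤ M := (abs_nonneg _).trans (haM 0)
  have hstep (u : ℝ) : |u + t * a u - u| ≤ t * M := by
    rw [add_sub_cancel_left, abs_mul, abs_of_pos ht]
    exact mul_le_mul_of_nonneg_left (haM u) ht.le
  have hprod := integrable_prod_ite_abs_sub_le_mul hf (t * M)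
  calc ∫ u in s, |t⁻¹ * ∫ v in s, stepDiff (u + t * a u) u v * f v|
      ≤ ∫ u in s, t⁻¹ * ∫ v in s, (if |v - u| ≤ t * M then (1 : ℝ) else 0) * |f v| := by
        refine integral_mono (((integrable_prod_stepDiff_mul hf ha t).integral_prod_left.const_mul
          _).abs) (hprod.integral_prod_left.const_mul _) fun u => ?_
        simp only [abs_mul, abs_of_pos (inv_pos.2 ht)]
        exact mul_le_mul_of_nonneg_left (abs_integral_stepDiff_mul_le hf u (hstep u))
          (inv_pos.2 ht).le
    _ = t⁻¹ * ∫ v in s, (∫ u in s, if |v - u| ≤ t * M then (1 : ℝ) else 0) * |f v| := by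
        rw [integral_const_mul, integral_integral_swap hprod]
        simp_rw [integral_mul_const]
    _ ≤ t⁻¹ * ∫ v in s, 2 * (t * M) * |f v| := by
        refine mul_le_mul_of_nonneg_left ?_ (inv_pos.2 ht).le
        refine integral_mono ?_ (hf.abs.const_mul _) fun v => ?_
        · have h := hprod.integral_prod_right
          simp_rw [integral_mul_const] at h
          exact h
        · refine mul_le_mul_of_nonneg_right ?_ (abs_nonneg _)
          simp_rw [abs_sub_comm v]
          exact integral_ite_abs_sub_le (by positivity) v s
    _ = 2 * M * ∫ v in s, |f v| := by
        rw [integral_const_mul]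
        field_simp

end

lemma integral_Icc_ite_mul {c : ℝ → ℝ} {x : ℝ} (hx : x ∈ Icc (0 : ℝ) 1) :
    ∫ v in Icc (0 : ℝ) 1, (if v ≤ x then (1 : ℝ) else 0) * c v = ∫ v in (0 : ℝ)..x, c v := by
  have h : (fun v => (if v ≤ x then (1 : ℝ) else 0) * c v) = (Iic x).indicator c := by
    ext v
    simp [Set.indicator]
  rw [h, setIntegral_indicator measurableSet_Iic, intervalIntegral.integral_of_le hx.1,
    ← integral_Icc_eq_integral_Ioc]
  congr 2
  ext v
  simp only [mem_inter_iff, mem_Icc, mem_Iic]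
  exact ⟨fun h => ⟨h.1.1, h.2⟩, fun h => ⟨⟨h.1, h.2.trans hx.2⟩, h.2⟩⟩

lemma integral_Icc_stepDiff_mul {c : ℝ → ℝ} (hc : Continuous c) {x u : ℝ}
    (hx : x ∈ Icc (0 : ℝ) 1) (hu : u ∈ Icc (0 : ℝ) 1) :
    ∫ v in Icc (0 : ℝ) 1, stepDiff x u v * c v
      = (∫ v in (0 : ℝ)..x, c v) - ∫ v in (0 : ℝ)..u, c v := by
  have hint (y : ℝ) :
      IntegrableOn (fun v => (if v ≤ y then (1 : ℝ) else 0) * c v) (Icc (0 : ℝ) 1) := by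
    refine (hc.integrableOn_Icc).bdd_mul (c := 1)
      (Measurable.ite measurableSet_Iic measurable_const measurable_const).aestronglyMeasurable
      (ae_of_all _ fun v => ?_)
    split_ifs <;> norm_num
  simp only [stepDiff, sub_mul]
  rw [integral_sub (hint x) (hint u), integral_Icc_ite_mul hx, integral_Icc_ite_mul hu]

lemma tendsto_inv_mul_integral_stepDiff {c a : ℝ → ℝ} (hc : Continuous c) {t : ℕ → ℝ}
    (ht : ∀ n, 0 < t n) (ht0 : Tendsto t atTop (𝓝 0)) {u : ℝ} (hu : u ∈ Ioo (0 : ℝ) 1) :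
    Tendsto (fun n => (t n)⁻¹ * ∫ v in Icc (0 : ℝ) 1, stepDiff (u + t n * a u) u v * c v)
      atTop (𝓝 (c u * a u)) := by
  have hF : HasDerivAt (fun x => ∫ v in (0 : ℝ)..x, c v) (c u) (u + 0 * a u) := by
    simpa using hc.integral_hasStrictDerivAt 0 u |>.hasDerivAt
  have hline : HasDerivAt (fun s : ℝ => u + s * a u) (a u) 0 := by
    simpa using ((hasDerivAt_id (0 : ℝ)).mul_const (a u)).const_add u
  have hslope := (hasDerivAt_iff_tendsto_slope_zero.1 (hF.comp (0 : ℝ) hline)).comp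
    (tendsto_nhdsWithin_iff.2 ⟨ht0, Eventually.of_forall fun n => (ht n).ne'⟩)
  refine hslope.congr' ?_
  have hlim : Tendsto (fun n => u + t n * a u) atTop (𝓝 u) := by
    simpa using (ht0.mul_const (a u)).const_add u
  filter_upwards [hlim.eventually (Icc_mem_nhds hu.1 hu.2)] with n hn
  rw [integral_Icc_stepDiff_mul hc hn (Ioo_subset_Icc_self hu)]
  simp

lemma tendsto_integral_abs_stepDiff_of_continuous {c a : ℝ → ℝ} (hc : Continuous c) {C M : ℝ}
    (hcC : ∀ u, |c u| ≤ C) (ha : Measurable a) (haM : ∀ u, |a u| ≤ M) {t : ℕ → ℝ}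
    (ht : ∀ n, 0 < t n) (ht0 : Tendsto t atTop (𝓝 0)) :
    Tendsto (fun n => ∫ u in Icc (0 : ℝ) 1,
      |(t n)⁻¹ * (∫ v in Icc (0 : ℝ) 1, stepDiff (u + t n * a u) u v * c v) - c u * a u|)
      atTop (𝓝 0) := by
  have hM : 0 ≤ M := (abs_nonneg _).trans (haM 0)
  have hC : 0 ≤ C := (abs_nonneg _).trans (hcC 0)
  have hci : IntegrableOn c (Icc (0 : ℝ) 1) := hc.integrableOn_Icc
  suffices h : Tendsto _ atTop (𝓝 (∫ _ in Icc (0 : ℝ) 1, (0 : ℝ))) by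
    rwa [integral_zero] at h
  refine tendsto_integral_of_dominated_convergence (f := fun _ => (0 : ℝ)) (fun _ => 2 * M * C + C * M) (fun n => ?_)
    (integrable_const _) (fun n => ae_of_all _ fun u => ?_) ?_
  · have hop := (integrable_prod_stepDiff_mul hci ha (t n)).integral_prod_left.const_mul (t n)⁻¹
    exact (hop.aestronglyMeasurable.sub (hc.measurable.mul ha).aestronglyMeasurable).norm
  · have hstep : |u + t n * a u - u| ≤ t n * M := by
      rw [add_sub_cancel_left, abs_mul, abs_of_pos (ht n)]
      exact mul_le_mul_of_nonneg_left (haM u) (ht n).le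
    rw [Real.norm_eq_abs, abs_abs]
    refine (abs_sub _ _).trans (add_le_add ?_ ?_)
    · rw [abs_mul, abs_of_pos (inv_pos.2 (ht n)), inv_mul_le_iff₀ (ht n)]
      have hite : Integrable (fun v : ℝ => if |v - u| ≤ t n * M then (1 : ℝ) else 0)
          (volume.restrict (Icc (0 : ℝ) 1)) := by
        refine Integrable.of_bound (C := 1)
          ((measurable_ite_abs_sub_le (t n * M)).comp (measurable_const.prodMk measurable_id)
            : Measurable fun v : ℝ => if |v - u| ≤ t n * M then (1 : ℝ) else 0).aestronglyMeasurable
          (ae_of_all _ fun v => ?_)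
        split_ifs <;> norm_num
      calc _ ≤ ∫ v in Icc (0 : ℝ) 1, (if |v - u| ≤ t n * M then (1 : ℝ) else 0) * |c v| :=
            abs_integral_stepDiff_mul_le hci u hstep
        _ ≤ ∫ v in Icc (0 : ℝ) 1, (if |v - u| ≤ t n * M then (1 : ℝ) else 0) * C := by
            refine integral_mono_of_nonneg (ae_of_all _ fun v => ?_) (hite.mul_const C)
              (ae_of_all _ fun v => ?_)
            · dsimp only [Pi.zero_apply]; positivity
            · exact mul_le_mul_of_nonneg_left (hcC v) (by positivity)
        _ ≤ 2 * (t n * M) * C := by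
            rw [integral_mul_const]
            exact mul_le_mul_of_nonneg_right
              (integral_ite_abs_sub_le (mul_nonneg (ht n).le hM) u _) hC
        _ = t n * (2 * M * C) := by ring
    · rw [abs_mul]
      exact mul_le_mul (hcC u) (haM u) (abs_nonneg _) hC
  · have hmem : ∀ᵐ u ∂volume.restrict (Icc (0 : ℝ) 1), u ∈ Ioo (0 : ℝ) 1 := by
      rw [← Measure.restrict_congr_set Ioo_ae_eq_Icc]
      exact ae_restrict_mem measurableSet_Ioo
    filter_upwards [hmem] with u hu
    simpa using ((tendsto_inv_mul_integral_stepDiff (a := a) hc ht ht0 hu).sub_const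
      (c u * a u)).abs

lemma tendsto_integral_abs_stepDiff {b a : ℝ → ℝ} (hb : IntegrableOn b (Icc (0 : ℝ) 1)) {M : ℝ}
    (ha : Measurable a) (haM : ∀ u, |a u| ≤ M) {t : ℕ → ℝ}
    (ht : ∀ n, 0 < t n) (ht0 : Tendsto t atTop (𝓝 0)) :
    Tendsto (fun n => ∫ u in Icc (0 : ℝ) 1,
      |(t n)⁻¹ * (∫ v in Icc (0 : ℝ) 1, stepDiff (u + t n * a u) u v * b v) - b u * a u|)
      atTop (𝓝 0) := by
  have hM : 0 ≤ M := (abs_nonneg _).trans (haM 0)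
  have hmul {g : ℝ → ℝ} (hg : IntegrableOn g (Icc (0 : ℝ) 1)) :
      IntegrableOn (fun u => g u * a u) (Icc (0 : ℝ) 1) :=
    by exact Integrable.mul_bdd (c := M) hg ha.aestronglyMeasurable (ae_of_all _ haM)
  have hop {g : ℝ → ℝ} (hg : IntegrableOn g (Icc (0 : ℝ) 1)) (n : ℕ) : IntegrableOn (fun u =>
      (t n)⁻¹ * (∫ v in Icc (0 : ℝ) 1, stepDiff (u + t n * a u) u v * g v)) (Icc (0 : ℝ) 1) :=
    (integrable_prod_stepDiff_mul hg ha (t n)).integral_prod_left.const_mul _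
  rw [Metric.tendsto_atTop]
  intro ε hε
  obtain ⟨c, hcs, hcb, hc, -⟩ := hb.exists_hasCompactSupport_integral_sub_le
    (ε := ε / (2 * (3 * M + 1))) (by positivity)
  obtain ⟨C, hcC⟩ := hcs.exists_bound_of_continuous hc
  have hci : IntegrableOn c (Icc (0 : ℝ) 1) := hc.integrableOn_Icc
  have hd : IntegrableOn (fun u => b u - c u) (Icc (0 : ℝ) 1) := hb.sub hci
  obtain ⟨N, hN⟩ := Metric.tendsto_atTop.1
    (tendsto_integral_abs_stepDiff_of_continuous hc hcC ha haM ht ht0) (ε / 2) (half_pos hε)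
  refine ⟨N, fun n hn => ?_⟩
  have hNn := hN n hn
  rw [Real.dist_eq, sub_zero, abs_of_nonneg (integral_nonneg fun _ => abs_nonneg _)] at hNn ⊢
  have hsplit (u : ℝ) : ∫ v in Icc (0 : ℝ) 1, stepDiff (u + t n * a u) u v * b v =
      (∫ v in Icc (0 : ℝ) 1, stepDiff (u + t n * a u) u v * (b v - c v)) +
      ∫ v in Icc (0 : ℝ) 1, stepDiff (u + t n * a u) u v * c v := by
    have hint {g : ℝ → ℝ} (hg : IntegrableOn g (Icc (0 : ℝ) 1)) : IntegrableOn (fun v =>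
        stepDiff (u + t n * a u) u v * g v) (Icc (0 : ℝ) 1) := by
      refine Integrable.bdd_mul (c := 1) hg
        ((measurable_stepDiff ha (t n)).comp
          (measurable_const (a := u) |>.prodMk measurable_id)).aestronglyMeasurable
        (ae_of_all _ fun v => ?_)
      refine (abs_stepDiff_le le_rfl v).trans ?_
      split_ifs <;> norm_num
    rw [← integral_add (hint hd) (hint hci)]
    congr 1 with v
    ring
  have hda : ∫ u in Icc (0 : ℝ) 1, |(b u - c u) * a u|
      ≤ M * ∫ u in Icc (0 : ℝ) 1, |b u - c u| := by
    rw [← integral_const_mul]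
    refine integral_mono (hmul hd).abs (hd.abs.const_mul _) fun u => ?_
    simp only [abs_mul]
    rw [mul_comm]
    exact mul_le_mul_of_nonneg_right (haM u) (abs_nonneg _)
  calc _ ≤ ∫ u in Icc (0 : ℝ) 1,
        (|(t n)⁻¹ * ∫ v in Icc (0 : ℝ) 1, stepDiff (u + t n * a u) u v * (b v - c v)|
        + |(b u - c u) * a u|
        + |(t n)⁻¹ * (∫ v in Icc (0 : ℝ) 1, stepDiff (u + t n * a u) u v * c v)
          - c u * a u|) := by
        refine integral_mono ((hop hb n).sub (hmul hb)).abs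
          (((hop hd n).abs.add (hmul hd).abs).add ((hop hci n).sub (hmul hci)).abs) fun u => ?_
        dsimp only
        rw [hsplit u]
        refine le_trans (le_of_eq ?_) ((abs_add_le _ _).trans
          (add_le_add_left (abs_sub _ _) _))
        congr 1
        ring
    _ ≤ 2 * M * (∫ u in Icc (0 : ℝ) 1, |b u - c u|) + M * (∫ u in Icc (0 : ℝ) 1, |b u - c u|)
        + ∫ u in Icc (0 : ℝ) 1,
          |(t n)⁻¹ * (∫ v in Icc (0 : ℝ) 1, stepDiff (u + t n * a u) u v * c v)
          - c u * a u| := by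
        have h₁ := (hop hd n).abs
        have h₂ := (hmul hd).abs
        have h₃ : IntegrableOn (fun u =>
            |(t n)⁻¹ * (∫ v in Icc (0 : ℝ) 1, stepDiff (u + t n * a u) u v * c v) - c u * a u|)
            (Icc (0 : ℝ) 1) := ((hop hci n).sub (hmul hci)).abs
        refine (integral_add (h₁.add h₂) h₃).trans_le ?_
        refine (congrArg (· + _) (integral_add h₁ h₂)).trans_le ?_
        gcongr
        exact integral_abs_integral_stepDiff_le hd ha haM (ht n)
    _ < ε / 2 + ε / 2 := by
        refine add_lt_add_of_le_of_lt ?_ hNn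
        have hI : ∫ u in Icc (0 : ℝ) 1, |b u - c u| ≤ ε / (2 * (3 * M + 1)) := hcb
        rw [le_div_iff₀ (by positivity)] at hI
        have : 0 ≤ ∫ u in Icc (0 : ℝ) 1, |b u - c u| := integral_nonneg fun _ => abs_nonneg _
        nlinarith
    _ = ε := add_halves ε

/-- With `ζₙ(u) = tₙ⁻¹ ∫₀¹ [1(v ≤ u + tₙ α(u)) − 1(v ≤ u)] b(v) dv`, one has
`∫₀¹ |ζₙ(u) − b(u)α(u)| du → 0`. -/
theorem zeta_tendsto_L1
    (b : ℝ → ℝ) (hb : IntegrableOn b (Set.Icc (0 : ℝ) 1))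
    (α : ℝ → ℝ) (hα : ContinuousOn α (Set.Icc (0 : ℝ) 1))
    (t : ℕ → ℝ) (ht : ∀ n, 0 < t n) (ht0 : Tendsto t atTop (𝓝 0)) :
    Tendsto (fun n => ∫ u in Set.Icc (0 : ℝ) 1,
      |(t n)⁻¹ * (∫ v in Set.Icc (0 : ℝ) 1,
          ((if v ≤ u + t n * α u then (1 : ℝ) else 0) - (if v ≤ u then 1 else 0)) * b v)
        - b u * α u|) atTop (𝓝 0) := by
  obtain ⟨M, hM⟩ := isCompact_Icc.exists_bound_of_continuousOn hα
  set a : ℝ → ℝ := IccExtend zero_le_one ((Icc (0 : ℝ) 1).domRestrict α) with ha_def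
  have ha : Continuous a := hα.domRestrict.Icc_extend'
  have haM (u : ℝ) : |a u| ≤ M := hM _ (projIcc (0 : ℝ) 1 zero_le_one u).2
  refine (tendsto_integral_abs_stepDiff hb ha.measurable haM ht ht0).congr fun n => ?_
  refine setIntegral_congr_fun measurableSet_Icc fun u hu => ?_
  have hau : a u = α u := by simp [ha_def, IccExtend_of_mem _ _ hu]
  simp only [hau, stepDiff]
end
end

section
/- Define χ_n : [0,1]² → ℝ by χ_n(u,v) = t_n^{-1} [ 1(v ≤ u + t_n α(u)) − 1(v ≤ u) ]. Then ∫₀¹ | ∫₀¹ χ_n(u,v) (b(v) − b(u)) dv | du → 0 as n → ∞. -/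
open MeasureTheory ProbabilityTheory Filter Set Topology

noncomputable section

/-- Schur-type bound for a symmetric nonnegative kernel. -/
theorem lintegral_lintegral_symm_kernel_mul_le {X : Type*} [MeasurableSpace X]
    {μ : Measure X} [SFinite μ] {K : X → X → ENNReal} (hK : Measurable (Function.uncurry K))
    (hsymm : ∀ u v, K u v = K v u) {C : ENNReal} (hC : ∀ u, ∫⁻ v, K u v ∂μ ≤ C)
    {f : X → ENNReal} (hf : AEMeasurable f μ) (δ : ENNReal) :
    ∫⁻ u, ∫⁻ v, K u v * (f v + f u + δ) ∂μ ∂μ ≤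
      C * (∫⁻ u, f u ∂μ) + C * (∫⁻ u, f u ∂μ) + C * δ * μ univ := by
  have hKu : ∀ u, Measurable (K u) := fun u => hK.of_uncurry_left
  have hrow : ∀ a : X → ENNReal, AEMeasurable a μ →
      ∫⁻ u, ∫⁻ v, K u v * a u ∂μ ∂μ ≤ C * ∫⁻ u, a u ∂μ := by
    intro a ha
    rw [← lintegral_const_mul'' _ ha]
    refine lintegral_mono fun u => ?_
    rw [lintegral_mul_const _ (hKu u)]
    gcongr
    exact hC u
  have hcol : ∫⁻ u, ∫⁻ v, K u v * f v ∂μ ∂μ ≤ C * ∫⁻ u, f u ∂μ := by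
    rw [lintegral_lintegral_swap (hK.aemeasurable.mul hf.comp_snd)]
    simpa only [hsymm] using hrow f hf
  have hmeas : ∀ a : X → X → ENNReal, AEMeasurable (Function.uncurry a) (μ.prod μ) →
      AEMeasurable (fun u => ∫⁻ v, K u v * a u v ∂μ) μ := fun a ha =>
    (hK.aemeasurable.mul ha).lintegral_prod_right'
  calc ∫⁻ u, ∫⁻ v, K u v * (f v + f u + δ) ∂μ ∂μ
      = ∫⁻ u, ((∫⁻ v, K u v * f v ∂μ) + (∫⁻ v, K u v * f u ∂μ)
          + ∫⁻ v, K u v * δ ∂μ) ∂μ := by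
        refine lintegral_congr fun u => ?_
        simp only [mul_add]
        rw [lintegral_add_right _ ((hKu u).mul_const δ),
          lintegral_add_right _ ((hKu u).mul_const (f u))]
    _ = (∫⁻ u, ∫⁻ v, K u v * f v ∂μ ∂μ) + (∫⁻ u, ∫⁻ v, K u v * f u ∂μ ∂μ)
          + ∫⁻ u, ∫⁻ v, K u v * δ ∂μ ∂μ := by
        rw [lintegral_add_right' _ (hmeas (fun _ _ => δ) aemeasurable_const),
          lintegral_add_right' _ (hmeas (fun u _ => f u) hf.comp_fst)]
    _ ≤ _ := by
        refine add_le_add (add_le_add hcol (hrow f hf)) ?_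
        simpa [mul_assoc] using hrow (fun _ => δ) aemeasurable_const

/-- The normalised indicator of the strip `|v - u| ≤ τ * M`. -/
def stripKernel (τ M u v : ℝ) : ENNReal :=
  {p : ℝ × ℝ | |p.2 - p.1| ≤ τ * M}.indicator (fun _ => ENNReal.ofReal τ⁻¹) (u, v)

theorem measurable_uncurry_stripKernel (τ M : ℝ) :
    Measurable (Function.uncurry (stripKernel τ M)) :=
  measurable_const.indicator (measurableSet_le (by fun_prop) measurable_const)

theorem stripKernel_symm (τ M u v : ℝ) : stripKernel τ M u v = stripKernel τ M v u := by
  simp only [stripKernel, indicator, mem_ofPred_eq, abs_sub_comm]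

theorem lintegral_stripKernel_le {τ : ℝ} (hτ : 0 < τ) (M u : ℝ) (s : Set ℝ) :
    ∫⁻ v in s, stripKernel τ M u v ≤ ENNReal.ofReal (2 * M) := by
  have hK : stripKernel τ M u =
      (Icc (u - τ * M) (u + τ * M)).indicator fun _ => ENNReal.ofReal τ⁻¹ := by
    ext v
    have : |v - u| ≤ τ * M ↔ v ∈ Icc (u - τ * M) (u + τ * M) := by
      rw [abs_le, mem_Icc]
      constructor <;> rintro ⟨h1, h2⟩ <;> constructor <;> linarith
    simp only [stripKernel, indicator, mem_ofPred_eq, this]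
  refine (setLIntegral_le_lintegral s _).trans ?_
  rw [hK, lintegral_indicator measurableSet_Icc, setLIntegral_const, Real.volume_Icc,
    ← ENNReal.ofReal_mul (inv_nonneg.2 hτ.le)]
  apply le_of_eq
  congr 1
  field_simp
  ring

theorem enorm_shifted_indicator_sub_le {τ M a : ℝ} (hτ : 0 < τ) (ha : |a| ≤ M) (u v : ℝ) :
    ‖τ⁻¹ * ((if v ≤ u + τ * a then (1 : ℝ) else 0) - (if v ≤ u then 1 else 0))‖ₑ
      ≤ stripKernel τ M u v := by
  have h1 := mul_le_mul_of_nonneg_left (abs_le.1 ha).1 hτ.le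
  have h2 := mul_le_mul_of_nonneg_left (abs_le.1 ha).2 hτ.le
  by_cases h : |v - u| ≤ τ * M
  · rw [stripKernel, indicator_of_mem (by exact h), Real.enorm_eq_ofReal_abs]
    apply ENNReal.ofReal_le_ofReal
    rw [abs_mul, abs_of_pos (inv_pos.2 hτ)]
    refine mul_le_of_le_one_right (inv_nonneg.2 hτ.le) ?_
    split_ifs <;> norm_num
  · have : (v ≤ u + τ * a) ↔ v ≤ u := by
      rw [abs_le, not_and_or] at h
      constructor <;> intro h' <;> rcases h with h | h <;> linarith
    simp [this]

/-- With `χₙ(u,v) = tₙ⁻¹ [1(v ≤ u + tₙ α(u)) − 1(v ≤ u)]`, one has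
`∫₀¹ | ∫₀¹ χₙ(u,v) (b(v) − b(u)) dv | du → 0`. -/
theorem chi_cross_term_tendsto
    (b : ℝ → ℝ) (hb : IntegrableOn b (Set.Icc (0 : ℝ) 1))
    (α : ℝ → ℝ) (hα : ContinuousOn α (Set.Icc (0 : ℝ) 1))
    (t : ℕ → ℝ) (ht : ∀ n, 0 < t n) (ht0 : Tendsto t atTop (𝓝 0)) :
    Tendsto (fun n => ∫ u in Set.Icc (0 : ℝ) 1,
      |∫ v in Set.Icc (0 : ℝ) 1,
        ((t n)⁻¹ * ((if v ≤ u + t n * α u then (1 : ℝ) else 0) - (if v ≤ u then 1 else 0)))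
          * (b v - b u)|) atTop (𝓝 0) := by
  obtain ⟨M, hM⟩ := isCompact_Icc.exists_bound_of_continuousOn hα
  rw [EMetric.tendsto_nhds]
  intro η hη
  set C := ENNReal.ofReal (2 * M)
  obtain ⟨ε, hε, hεη⟩ := ENNReal.exists_nnreal_pos_mul_lt
    (ENNReal.mul_ne_top (ENNReal.ofReal_ne_top (r := 2 * M)) (ENNReal.ofNat_ne_top (n := 3)))
    hη.ne'
  obtain ⟨g, hgsupp, hbg, hgc, -⟩ := hb.exists_hasCompactSupport_lintegral_sub_le
    (ENNReal.coe_ne_zero.2 hε.ne')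
  obtain ⟨δ, hδ, hgδ⟩ := Metric.uniformContinuous_iff.1
    (hgsupp.uniformContinuous_of_continuous hgc) ε hε
  have hsmall : ∀ᶠ n in atTop, t n * M < δ := by
    have : Tendsto (fun n => t n * M) atTop (𝓝 0) := by simpa using ht0.mul_const M
    exact this.eventually_lt_const hδ
  filter_upwards [hsmall] with n hn
  set μ := (volume : Measure ℝ).restrict (Icc 0 1)
  have hpt : ∀ u ∈ Icc (0 : ℝ) 1, ∀ v,
      ‖((t n)⁻¹ * ((if v ≤ u + t n * α u then (1 : ℝ) else 0) - (if v ≤ u then 1 else 0)))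
          * (b v - b u)‖ₑ
        ≤ stripKernel (t n) M u v * (‖b v - g v‖ₑ + ‖b u - g u‖ₑ + ε) := by
    intro u hu v
    rw [enorm_mul]
    refine (mul_le_mul_left (enorm_shifted_indicator_sub_le (ht n) (hM u hu) u v) _).trans ?_
    by_cases h : |v - u| ≤ t n * M
    · gcongr
      have hgε : ‖g v - g u‖ₑ ≤ ε := by
        rw [← edist_eq_enorm_sub, edist_le_coe, ← NNReal.coe_le_coe, coe_nndist]
        exact (hgδ (h.trans_lt hn)).le
      calc ‖b v - b u‖ₑ = ‖(b v - g v) - (b u - g u) + (g v - g u)‖ₑ := by congr 1; ring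
        _ ≤ ‖(b v - g v) - (b u - g u)‖ₑ + ‖g v - g u‖ₑ := enorm_add_le _ _
        _ ≤ _ := add_le_add enorm_sub_le hgε
    · simp [stripKernel, h]
  rw [edist_zero_right]
  calc _ ≤ ∫⁻ u, ∫⁻ v, stripKernel (t n) M u v *
        (‖b v - g v‖ₑ + ‖b u - g u‖ₑ + ε) ∂μ ∂μ := by
        refine (enorm_integral_le_lintegral_enorm _).trans
          (setLIntegral_mono' measurableSet_Icc fun u hu => ?_)
        rw [Real.enorm_abs]
        exact (enorm_integral_le_lintegral_enorm _).trans (lintegral_mono (hpt u hu))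
    _ ≤ C * (∫⁻ u, ‖b u - g u‖ₑ ∂μ) + C * (∫⁻ u, ‖b u - g u‖ₑ ∂μ) + C * ε * μ univ :=
        lintegral_lintegral_symm_kernel_mul_le (measurable_uncurry_stripKernel _ _)
          (stripKernel_symm _ _) (fun u => lintegral_stripKernel_le (ht n) M u _)
          (hb.aestronglyMeasurable.sub hgc.aestronglyMeasurable).enorm ε
    _ ≤ C * ε + C * ε + C * ε * 1 := by
        gcongr
        simp [μ]
    _ = ε * (C * 3) := by ring
    _ < η := hεη
end
end

section
/- Define χ_n : [0,1]² → ℝ by χ_n(u,v) = t_n^{-1} [ 1(v ≤ u + t_n α(u)) − 1(v ≤ u) ]. Then for every ε > 0 there exists N such that for all n ≥ N and all v ∈ [0,1], ∫₀¹ | χ_n(u,v) | du ≤ sup_{u∈[0,1]} |α(u)| + 2ε. -/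
open MeasureTheory ProbabilityTheory Filter Set Topology

noncomputable section

/-- If `a` is `ε`-close to `α u` whenever `u ∈ [0,1]` is within `s * M` of `v`, the points `u` at which
`1(v ≤ u + s α(u))` and `1(v ≤ u)` differ lie in an interval of length at most `s (|a| + 2ε)`. -/
theorem abs_scaled_indicator_sub_le {α : ℝ → ℝ} {s a ε M u v : ℝ} (hs : 0 < s)
    (hM : |α u| ≤ M) (hclose : |u - v| ≤ s * M → |α u - a| ≤ ε) :
    |s⁻¹ * ((if v ≤ u + s * α u then (1 : ℝ) else 0) - (if v ≤ u then 1 else 0))| ≤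
      (Icc (v - s * max (a + ε) 0) (v + s * max (ε - a) 0)).indicator (fun _ => s⁻¹) u := by
  have hs' : 0 < s⁻¹ := inv_pos.2 hs
  have hsM : |s * α u| ≤ s * M := by
    rw [abs_mul, abs_of_pos hs]
    gcongr
  obtain ⟨hM₁, hM₂⟩ := abs_le.1 hsM
  have hp : 0 ≤ s * max (a + ε) 0 := by positivity
  have hq : 0 ≤ s * max (ε - a) 0 := by positivity
  have hnonneg : 0 ≤ (Icc (v - s * max (a + ε) 0) (v + s * max (ε - a) 0)).indicator
      (fun _ => s⁻¹) u := indicator_nonneg (fun _ _ => hs'.le) u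
  by_cases h₁ : v ≤ u + s * α u <;> by_cases h₂ : v ≤ u
  · simpa [h₁, h₂] using hnonneg
  · obtain ⟨-, hα⟩ := abs_le.1 (hclose (abs_le.2 ⟨by linarith, by linarith⟩))
    have hle : s * α u ≤ s * max (a + ε) 0 := by
      gcongr
      exact le_max_of_le_left (by linarith)
    rw [indicator_of_mem (show u ∈ Icc _ _ from ⟨by linarith, by linarith⟩)]
    simp [h₁, h₂, abs_of_pos hs]
  · obtain ⟨hα, -⟩ := abs_le.1 (hclose (abs_le.2 ⟨by linarith, by linarith⟩))
    have hle : s * -α u ≤ s * max (ε - a) 0 := by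
      gcongr
      exact le_max_of_le_left (by linarith)
    rw [indicator_of_mem (show u ∈ Icc _ _ from ⟨by linarith, by linarith⟩)]
    simp [h₁, h₂, abs_of_pos hs]
  · simpa [h₁, h₂] using hnonneg

theorem max_add_max_sub_le {a ε : ℝ} (hε : 0 ≤ ε) :
    max (a + ε) 0 + max (ε - a) 0 ≤ |a| + 2 * ε := by
  have h₁ := le_abs_self a
  have h₂ := neg_le_abs a
  rcases max_cases (a + ε) 0 with h | h <;> rcases max_cases (ε - a) 0 with h' | h' <;>
    linarith [abs_nonneg a]

/-- With `χₙ(u,v) = tₙ⁻¹ [1(v ≤ u + tₙ α(u)) − 1(v ≤ u)]`: for every `ε > 0` there is `N` such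
that for all `n ≥ N` and all `v ∈ [0,1]`, `∫₀¹ |χₙ(u,v)| du ≤ sup_{u ∈ [0,1]} |α(u)| + 2ε`. -/
theorem chi_integral_bound
    (α : ℝ → ℝ) (hα : ContinuousOn α (Set.Icc (0 : ℝ) 1))
    (t : ℕ → ℝ) (ht : ∀ n, 0 < t n) (ht0 : Tendsto t atTop (𝓝 0)) :
    ∀ ε > (0 : ℝ), ∃ N : ℕ, ∀ n ≥ N, ∀ v ∈ Set.Icc (0 : ℝ) 1,
      (∫ u in Set.Icc (0 : ℝ) 1,
        |(t n)⁻¹ * ((if v ≤ u + t n * α u then (1 : ℝ) else 0) - (if v ≤ u then 1 else 0))|)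
        ≤ (⨆ u : Set.Icc (0 : ℝ) 1, |α u|) + 2 * ε := by
  intro ε hε
  set M := ⨆ u : Set.Icc (0 : ℝ) 1, |α u|
  have hbdd : BddAbove (range fun u : Set.Icc (0 : ℝ) 1 => |α u|) := by
    have h := (isCompact_Icc.image_of_continuousOn hα.abs).bddAbove
    rwa [image_eq_range] at h
  have hM : ∀ u ∈ Set.Icc (0 : ℝ) 1, |α u| ≤ M := fun u hu => le_ciSup hbdd ⟨u, hu⟩
  obtain ⟨δ, hδ, huc⟩ := Metric.uniformContinuousOn_iff.1
    (isCompact_Icc.uniformContinuousOn_of_continuous hα) ε hε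
  have hlim : Tendsto (fun n => t n * M) atTop (𝓝 0) := by
    simpa using ht0.mul_const M
  obtain ⟨N, hN⟩ := eventually_atTop.1 (hlim.eventually_lt_const hδ)
  refine ⟨N, fun n hn v hv => ?_⟩
  have hs := ht n
  set p := v - t n * max (α v + ε) 0 with hp
  set q := v + t n * max (ε - α v) 0 with hq
  have hpq : p ≤ q := by
    have h₁ : 0 ≤ t n * max (α v + ε) 0 := by positivity
    have h₂ : 0 ≤ t n * max (ε - α v) 0 := by positivity
    linarith
  calc
    _ ≤ ∫ u in Set.Icc (0 : ℝ) 1, (Icc p q).indicator (fun _ => (t n)⁻¹) u := by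
      refine integral_mono_of_nonneg (ae_of_all _ fun _ => abs_nonneg _)
        ((integrable_const _).indicator measurableSet_Icc) ?_
      filter_upwards [ae_restrict_mem measurableSet_Icc] with u hu
      refine abs_scaled_indicator_sub_le hs (hM u hu) fun h => ?_
      exact (huc u hu v hv (h.trans_lt (hN n hn))).le
    _ = (volume.restrict (Set.Icc (0 : ℝ) 1)).real (Icc p q) * (t n)⁻¹ := by
      rw [integral_indicator_const _ measurableSet_Icc, smul_eq_mul]
    _ ≤ (q - p) * (t n)⁻¹ := by
      gcongr
      rw [← Real.volume_real_Icc_of_le hpq, measureReal_restrict_apply measurableSet_Icc]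
      exact measureReal_mono inter_subset_left measure_Icc_lt_top.ne
    _ = max (α v + ε) 0 + max (ε - α v) 0 := by
      rw [hp, hq]
      field_simp
      ring
    _ ≤ |α v| + 2 * ε := max_add_max_sub_le hε.le
    _ ≤ M + 2 * ε := by
      gcongr
      exact hM v hv
end
end

section
/- Let μ be a finite Borel measure on (0,1), let g : (0,1) → [0,∞) be Lebesgue integrable, and let c ≥ 0. Suppose that for all a, b with 0 < a ≤ b < 1, ∫_{[a,b]} √(u(1−u)) dμ(u) ≤ ∫_a^b g(u) du + c (b − a). Then μ is absolutely continuous with respect to Lebesgue measure on (0,1). -/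
open MeasureTheory ProbabilityTheory Filter Set Topology

noncomputable section

/-- The distribution function of a finite measure on `ℝ` is right-continuous. -/
theorem continuousWithinAt_measureReal_Iic (ν : Measure ℝ) [IsFiniteMeasure ν] (x : ℝ) :
    ContinuousWithinAt (fun t => ν.real (Set.Iic t)) (Set.Ici x) x := by
  rw [← continuousWithinAt_Ioi_iff_Ici]
  have h := tendsto_measure_biInter_gt (μ := ν) (s := fun t : ℝ => Set.Iic t) (a := x)
    (fun r _ => measurableSet_Iic.nullMeasurableSet)
    (fun i j _ hij => Set.Iic_subset_Iic.2 hij) ⟨x + 1, by simp, measure_ne_top _ _⟩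
  have hInter : (⋂ r > x, Set.Iic r) = Set.Iic x := by
    ext y
    simp only [Set.mem_iInter, Set.mem_Iic]
    exact ⟨le_of_forall_gt_imp_ge_of_dense, fun hy r hr => hy.trans hr.le⟩
  rw [hInter] at h
  exact (ENNReal.tendsto_toReal (measure_ne_top ν _)).comp h

theorem measureReal_Iic_sub_Iic (ν : Measure ℝ) [IsFiniteMeasure ν] {a b : ℝ} (hab : a ≤ b) :
    ν.real (Set.Iic b) - ν.real (Set.Iic a) = ν.real (Set.Ioc a b) := by
  rw [← Set.Iic_union_Ioc_eq_Iic hab, measureReal_union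
    (Set.Iic_disjoint_Ioc le_rfl) measurableSet_Ioc]
  ring

/-- Finite measures on `ℝ` may be compared on half-open intervals. -/
theorem measure_le_of_forall_Ioc_le (ν₁ ν₂ : Measure ℝ) [IsFiniteMeasure ν₁] [IsFiniteMeasure ν₂]
    (h : ∀ a b : ℝ, a < b → ν₁ (Set.Ioc a b) ≤ ν₂ (Set.Ioc a b)) : ν₁ ≤ ν₂ := by
  have hreal : ∀ a b : ℝ, a < b → ν₁.real (Set.Ioc a b) ≤ ν₂.real (Set.Ioc a b) :=
    fun a b hab => ENNReal.toReal_mono (measure_ne_top _ _) (h a b hab)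
  let F : StieltjesFunction ℝ :=
    { toFun := fun t => ν₂.real (Set.Iic t) - ν₁.real (Set.Iic t)
      mono' := by
        intro a b hab
        rcases hab.eq_or_lt with rfl | hlt
        · rfl
        · have h₁ := measureReal_Iic_sub_Iic ν₁ hab
          have h₂ := measureReal_Iic_sub_Iic ν₂ hab
          have h₃ := hreal a b hlt
          dsimp only
          linarith
      right_continuous' := fun x =>
        (continuousWithinAt_measureReal_Iic ν₂ x).sub (continuousWithinAt_measureReal_Iic ν₁ x) }
  have hsum : ν₂ = ν₁ + F.measure := by
    refine Measure.ext_of_Ioc _ _ fun a b hab => ?_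
    have hF : F b - F a = ν₂.real (Set.Ioc a b) - ν₁.real (Set.Ioc a b) := by
      rw [← measureReal_Iic_sub_Iic ν₁ hab.le, ← measureReal_Iic_sub_Iic ν₂ hab.le]
      change (ν₂.real (Set.Iic b) - ν₁.real (Set.Iic b))
        - (ν₂.real (Set.Iic a) - ν₁.real (Set.Iic a)) = _
      ring
    rw [Measure.add_apply, F.measure_Ioc, hF, ENNReal.ofReal_sub _ measureReal_nonneg,
      ofReal_measureReal, ofReal_measureReal, add_tsub_cancel_of_le (h a b hab)]
  rw [hsum]
  exact Measure.le_add_right le_rfl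

/-- Finite measures concentrated on `(0,1)` may be compared on compact subintervals. -/
theorem measure_le_of_forall_Icc_le (ν₁ ν₂ : Measure ℝ) [IsFiniteMeasure ν₁] [IsFiniteMeasure ν₂]
    (h₁ : ν₁ (Set.Ioo (0 : ℝ) 1)ᶜ = 0)
    (h : ∀ a b : ℝ, 0 < a → a ≤ b → b < 1 → ν₁ (Set.Icc a b) ≤ ν₂ (Set.Icc a b)) : ν₁ ≤ ν₂ := by
  refine measure_le_of_forall_Ioc_le ν₁ ν₂ fun x y _ => ?_
  let s : ℕ → Set ℝ := fun n =>
    Set.Icc (max x 0 + 1 / ((n : ℝ) + 1)) (min y (1 - 1 / ((n : ℝ) + 1)))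
  have hpos : ∀ n : ℕ, (0 : ℝ) < 1 / ((n : ℝ) + 1) := fun n => Nat.one_div_pos_of_nat
  have hs : Monotone s := fun m n hmn => by
    have := Nat.one_div_le_one_div (α := ℝ) hmn
    exact Set.Icc_subset_Icc (by gcongr) (by gcongr)
  have hsub : Set.Ioc x y ∩ Set.Ioo 0 1 ⊆ ⋃ n, s n := by
    rintro u ⟨⟨hxu, huy⟩, hu0, hu1⟩
    have hlt : 0 < min (u - max x 0) (1 - u) :=
      lt_min (sub_pos.2 (max_lt hxu hu0)) (sub_pos.2 hu1)
    obtain ⟨n, hn⟩ := exists_nat_one_div_lt hlt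
    obtain ⟨hn₁, hn₂⟩ := lt_min_iff.1 hn
    exact Set.mem_iUnion.2 ⟨n, by linarith, le_min huy (by linarith)⟩
  calc ν₁ (Set.Ioc x y) = ν₁ (Set.Ioc x y ∩ Set.Ioo 0 1) :=
        (measure_inter_conull h₁).symm
    _ ≤ ν₁ (⋃ n, s n) := measure_mono hsub
    _ = ⨆ n, ν₁ (s n) := hs.measure_iUnion
    _ ≤ ν₂ (Set.Ioc x y) := by
      refine iSup_le fun n => ?_
      rcases lt_or_ge (min y (1 - 1 / ((n : ℝ) + 1))) (max x 0 + 1 / ((n : ℝ) + 1)) with hn | hn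
      · simp only [s, Set.Icc_eq_empty_of_lt hn, measure_empty, zero_le]
      · refine (h _ _ ?_ hn ?_).trans (measure_mono fun u hu => ⟨?_, hu.2.trans (min_le_left _ _)⟩)
        · exact add_pos_of_nonneg_of_pos (le_max_right _ _) (hpos n)
        · exact (min_le_right _ _).trans_lt (sub_lt_self _ (hpos n))
        · exact ((le_max_left x 0).trans_lt (lt_add_of_pos_right _ (hpos n))).trans_le hu.1

/-- If a finite Borel measure `μ` on `(0,1)` satisfies
`∫_{[a,b]} √(u(1−u)) dμ ≤ ∫_a^b g + c(b−a)` for all `0 < a ≤ b < 1`, with `g` integrable and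
nonnegative and `c ≥ 0`, then `μ` is absolutely continuous with respect to Lebesgue measure on
`(0,1)`. -/
theorem absolutelyContinuous_of_interval_bound
    (μ : Measure ℝ) [IsFiniteMeasure μ] (hμ : μ (Set.Ioo (0 : ℝ) 1)ᶜ = 0)
    (g : ℝ → ℝ) (hg : IntegrableOn g (Set.Ioo (0 : ℝ) 1))
    (hg0 : ∀ u ∈ Set.Ioo (0 : ℝ) 1, 0 ≤ g u)
    (c : ℝ) (hc : 0 ≤ c)
    (hbound : ∀ a b : ℝ, 0 < a → a ≤ b → b < 1 →
      (∫ u in Set.Icc a b, Real.sqrt (u * (1 - u)) ∂μ) ≤ (∫ u in a..b, g u) + c * (b - a)) :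
    μ ≪ volume.restrict (Set.Ioo (0 : ℝ) 1) := by
  set w : ℝ → ℝ := fun u => Real.sqrt (u * (1 - u)) with hw
  have hwcont : Continuous w := by fun_prop
  have hwint : Integrable w μ := by
    refine Integrable.of_bound hwcont.aestronglyMeasurable 1 (ae_of_all _ fun u => ?_)
    rw [Real.norm_of_nonneg (Real.sqrt_nonneg _)]
    exact Real.sqrt_le_one.2 (by nlinarith [sq_nonneg (u - 1 / 2)])
  have hμw : μ ≪ μ.withDensity fun u => ENNReal.ofReal (w u) := by
    refine withDensity_absolutelyContinuous' (by fun_prop) ?_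
    filter_upwards [measure_eq_zero_iff_ae_notMem.1 hμ] with u hu
    rw [Set.notMem_compl_iff] at hu
    exact (ENNReal.ofReal_pos.2 (Real.sqrt_pos.2 (mul_pos hu.1 (sub_pos.2 hu.2)))).ne'
  have hgc : IntegrableOn (fun u => g u + c) (Set.Ioo (0 : ℝ) 1) :=
    hg.add (integrableOn_const (by simp))
  have := isFiniteMeasure_withDensity_ofReal hwint.2
  have := isFiniteMeasure_withDensity_ofReal hgc.2
  refine hμw.trans ((Measure.absolutelyContinuous_of_le ?_).trans
    (withDensity_absolutelyContinuous _ fun u => ENNReal.ofReal (g u + c)))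
  refine measure_le_of_forall_Icc_le _ _ (withDensity_absolutelyContinuous _ _ hμ)
    fun a b ha hab hb => ?_
  have hsub : Set.Icc a b ⊆ Set.Ioo (0 : ℝ) 1 := Set.Icc_subset_Ioo ha hb
  have hgab : IntegrableOn g (Set.Icc a b) := hg.mono_set hsub
  rw [withDensity_apply _ measurableSet_Icc, withDensity_apply _ measurableSet_Icc,
    Measure.restrict_restrict_of_subset hsub,
    ← ofReal_integral_eq_lintegral_ofReal hwint.integrableOn
      (ae_of_all _ fun u => Real.sqrt_nonneg _),
    ← ofReal_integral_eq_lintegral_ofReal (hgc.mono_set hsub)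
      ((ae_restrict_iff' measurableSet_Icc).2
        (ae_of_all _ fun u hu => add_nonneg (hg0 u (hsub hu)) hc))]
  refine ENNReal.ofReal_le_ofReal ((hbound a b ha hab hb).trans_eq ?_)
  rw [integral_add hgab (integrableOn_const (by simp)), intervalIntegral.integral_of_le hab,
    integral_Icc_eq_integral_Ioc, setIntegral_const, Real.volume_real_Icc_of_le hab, smul_eq_mul,
    mul_comm c]
end
end

section
/- Let ν₁ and ν₂ be Borel probability measures on ℝ with cdfs H_i(x) = ν_i((−∞, x]) and quantile functions q_i(u) = inf{x ∈ ℝ : H_i(x) ≥ u} for u ∈ (0,1). Then ∫_ℝ |H₁(x) − H₂(x)| dx = ∫₀¹ |q₁(u) − q₂(u)| du (as an equality in [0, ∞]); i.e., the L¹-distance between any two cdfs equals the L¹-distance between the corresponding quantile functions. -/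
open MeasureTheory ProbabilityTheory Filter Set Topology

noncomputable section

/-- The Galois connection between a cdf and its quantile function. -/
theorem sInf_le_cdf_le_iff (ν : Measure ℝ) [IsProbabilityMeasure ν] {u : ℝ}
    (hu : u ∈ Ioo (0 : ℝ) 1) (x : ℝ) : sInf {y | u ≤ cdf ν y} ≤ x ↔ u ≤ cdf ν x := by
  have hne : {y | u ≤ cdf ν y}.Nonempty :=
    ((tendsto_cdf_atTop ν).eventually (Ici_mem_nhds hu.2)).exists
  have hbdd : BddBelow {y | u ≤ cdf ν y} := by
    obtain ⟨b, hb⟩ := ((tendsto_cdf_atBot ν).eventually (Iio_mem_nhds hu.1)).exists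
    refine ⟨b, fun y hy => le_of_not_gt fun hyb => ?_⟩
    exact absurd (hy.trans (monotone_cdf ν hyb.le)) (not_le.2 hb)
  refine ⟨fun h => ?_, fun h => csInf_le hbdd h⟩
  have hright : Tendsto (cdf ν) (𝓝[>] x) (𝓝 (cdf ν x)) :=
    ((cdf ν).right_continuous x).mono Ioi_subset_Ici_self
  refine ge_of_tendsto hright (eventually_mem_nhdsWithin.mono fun z hz => ?_)
  obtain ⟨y, hy, hyz⟩ := exists_lt_of_csInf_lt hne (h.trans_lt hz)
  exact hy.trans (monotone_cdf ν hyz.le)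

theorem volume_restrict_Ioo_uIoc {a b : ℝ} (ha : a ∈ Icc (0 : ℝ) 1) (hb : b ∈ Icc (0 : ℝ) 1) :
    volume.restrict (Ioo (0 : ℝ) 1) (uIoc a b) = ENNReal.ofReal |a - b| := by
  rw [Measure.restrict_congr_set Ioo_ae_eq_Ioc, Measure.restrict_apply measurableSet_uIoc,
    inter_eq_left.2 (show uIoc a b ⊆ Ioc 0 1 from
      Ioc_subset_Ioc (le_min ha.1 hb.1) (max_le ha.2 hb.2)), Real.volume_uIoc,
    abs_sub_comm]

theorem volume_setOf_mem_uIoc_cdf (ν₁ ν₂ : Measure ℝ) [IsProbabilityMeasure ν₁]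
    [IsProbabilityMeasure ν₂] {u : ℝ} (hu : u ∈ Ioo (0 : ℝ) 1) :
    volume {x | u ∈ uIoc (cdf ν₁ x) (cdf ν₂ x)} =
      ENNReal.ofReal |sInf {x | u ≤ cdf ν₁ x} - sInf {x | u ≤ cdf ν₂ x}| := by
  have h : {x | u ∈ uIoc (cdf ν₁ x) (cdf ν₂ x)} =
      Ico (min (sInf {x | u ≤ cdf ν₁ x}) (sInf {x | u ≤ cdf ν₂ x}))
        (max (sInf {x | u ≤ cdf ν₁ x}) (sInf {x | u ≤ cdf ν₂ x})) := by
    ext x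
    simp only [mem_ofPred_eq, mem_uIoc, mem_Ico, min_le_iff, max_le_iff, ← not_le,
      sInf_le_cdf_le_iff _ hu]
    tauto
  rw [h, Real.volume_Ico, max_sub_min_eq_abs']

/-- The `L¹`-distance between two cdfs equals the `L¹`-distance between the corresponding
quantile functions (as an equality in `[0,∞]`). -/
theorem lintegral_cdf_dist_eq_lintegral_quantile_dist
    (ν₁ ν₂ : Measure ℝ) [IsProbabilityMeasure ν₁] [IsProbabilityMeasure ν₂] :
    (∫⁻ x, ENNReal.ofReal
        |(ν₁ (Set.Iic x)).toReal - (ν₂ (Set.Iic x)).toReal| ∂volume) =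
      ∫⁻ u in Set.Ioo (0 : ℝ) 1, ENNReal.ofReal
        |sInf {x : ℝ | u ≤ (ν₁ (Set.Iic x)).toReal}
          - sInf {x : ℝ | u ≤ (ν₂ (Set.Iic x)).toReal}| ∂volume := by
  simp only [← measureReal_def, ← cdf_eq_real]
  have hS : MeasurableSet {p : ℝ × ℝ | p.2 ∈ uIoc (cdf ν₁ p.1) (cdf ν₂ p.1)} := by
    have h₁ : Measurable fun p : ℝ × ℝ => cdf ν₁ p.1 :=
      (monotone_cdf ν₁).measurable.comp measurable_fst
    have h₂ : Measurable fun p : ℝ × ℝ => cdf ν₂ p.1 :=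
      (monotone_cdf ν₂).measurable.comp measurable_fst
    exact (measurableSet_lt (h₁.min h₂) measurable_snd).inter
      (measurableSet_le measurable_snd (h₁.max h₂))
  calc
    _ = ∫⁻ x, volume.restrict (Ioo (0 : ℝ) 1) (uIoc (cdf ν₁ x) (cdf ν₂ x)) :=
      lintegral_congr fun x => (volume_restrict_Ioo_uIoc
        ⟨cdf_nonneg _ _, cdf_le_one _ _⟩ ⟨cdf_nonneg _ _, cdf_le_one _ _⟩).symm
    _ = (volume.prod (volume.restrict (Ioo (0 : ℝ) 1)))
          {p : ℝ × ℝ | p.2 ∈ uIoc (cdf ν₁ p.1) (cdf ν₂ p.1)} := (Measure.prod_apply hS).symm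
    _ = ∫⁻ u in Ioo (0 : ℝ) 1, volume {x | u ∈ uIoc (cdf ν₁ x) (cdf ν₂ x)} :=
      Measure.prod_apply_symm hS
    _ = _ := setLIntegral_congr_fun measurableSet_Ioo fun u hu =>
      volume_setOf_mem_uIoc_cdf ν₁ ν₂ hu
end
end
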